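/- Let Z be a set of 2d+1 distinct points in P^2 over C, d ≥ 2. Suppose there exist a line L_Q containing exactly d points of Z and a line L_R containing exactly 2 points of Z, with L_Q ∩ L_R not a point of Z. Suppose F is a homogeneous polynomial of degree d vanishing on Z and vanishing to order at least d−1 at a point P chosen generically on L_R (in particular P ∉ Z, P ∉ L_Q, and P not on any line joining two points of Z \ L_R). Then F = 0. -/

import Mathlib

open MvPolynomial

noncomputable section

abbrev P2 := Projectivization ℂ (Fin 3 → ℂ)

/-- A projective line in `P2`, given as the zero set of a nonzero linear form. -/
def IsLine (S : Set P2) : Prop :=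
  ∃ f : (Fin 3 → ℂ) →ₗ[ℂ] ℂ, f ≠ 0 ∧ S = {p : P2 | f p.rep = 0}

/-- Three points of `P2` are collinear if some line contains all of them. -/
def Collinear3 (p q r : P2) : Prop :=
  ∃ S : Set P2, IsLine S ∧ p ∈ S ∧ q ∈ S ∧ r ∈ S

/-- A point of `P2` from homogeneous coordinates. -/
def pt (v : Fin 3 → ℂ) (h : v ≠ 0) : P2 := Projectivization.mk ℂ v h

/-- Two sets of points of `P2` are projectively equivalent if a linear automorphism
of `ℂ³` carries one onto the other. -/
def ProjEquiv (A B : Set P2) : Prop :=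
  ∃ g : (Fin 3 → ℂ) ≃ₗ[ℂ] (Fin 3 → ℂ),
    B = Projectivization.map (g : (Fin 3 → ℂ) →ₗ[ℂ] (Fin 3 → ℂ)) g.injective '' A


/-- Restriction of a polynomial to a parametrized affine line. -/
def lineP (F : MvPolynomial (Fin 3) ℂ) (u v : Fin 3 → ℂ) : Polynomial ℂ :=
  aeval (fun i => Polynomial.C (u i) + Polynomial.C (v i) * Polynomial.X) F

theorem eval_lineP (F : MvPolynomial (Fin 3) ℂ) (u v : Fin 3 → ℂ) (x : ℂ) :
    (lineP F u v).eval x = eval (u + x • v) F := by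
  induction F using MvPolynomial.induction_on with
  | C a => rw [lineP, aeval_C, eval_C]; exact Polynomial.eval_C
  | add p q hp hq => simp only [lineP, map_add, Polynomial.eval_add] at *; rw [hp, hq]
  | mul_X p i hp =>
    simp only [lineP, map_mul, Polynomial.eval_mul] at *
    rw [hp]
    simp only [aeval_X, eval_X, Polynomial.eval_add, Polynomial.eval_mul, Polynomial.eval_C,
      Polynomial.eval_X, Pi.add_apply, Pi.smul_apply, smul_eq_mul]
    ring

theorem deriv_lineP (F : MvPolynomial (Fin 3) ℂ) (u v : Fin 3 → ℂ) :
    (lineP F u v).derivative = ∑ i, Polynomial.C (v i) * lineP (pderiv i F) u v := by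
  induction F using MvPolynomial.induction_on with
  | C a => simp [lineP]
  | add p q hp hq =>
    simp only [lineP, map_add] at *; rw [hp, hq]; simp only [Fin.sum_univ_three]; ring
  | mul_X p i hp =>
    simp only [lineP, map_mul, Polynomial.derivative_mul] at *
    rw [hp]
    simp only [Fin.sum_univ_three, Derivation.leibniz, pderiv_X, smul_eq_mul, map_add, map_mul]
    fin_cases i <;> simp <;> ring

theorem mult_lineP (u v : Fin 3 → ℂ) (m : ℕ) : ∀ F : MvPolynomial (Fin 3) ℂ,
    (∀ l : List (Fin 3), l.length < m →
      eval u (l.foldr (fun i G => pderiv i G) F) = 0) →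
    Polynomial.X ^ m ∣ lineP F u v := by
  induction m with
  | zero => intro F _; simp
  | succ m ih =>
    intro F h
    have h0 : (lineP F u v).coeff 0 = 0 := by
      rw [Polynomial.coeff_zero_eq_eval_zero, eval_lineP]
      simpa using h [] (by simp)
    have h1 : Polynomial.X ^ m ∣ (lineP F u v).derivative := by
      rw [deriv_lineP]
      refine Finset.dvd_sum fun i _ => Dvd.dvd.mul_left (ih _ fun l hl => ?_) _
      have := h (l ++ [i]) (by simpa using hl)
      simpa using this
    rw [Polynomial.X_pow_dvd_iff] at h1 ⊢
    intro k hk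
    cases k with
    | zero => exact h0
    | succ k =>
      have := h1 k (by omega)
      rw [Polynomial.coeff_derivative] at this
      have hk : ((k : ℂ) + 1) ≠ 0 := by exact_mod_cast Nat.succ_ne_zero k
      exact (mul_eq_zero.mp this).resolve_right hk

theorem natDegree_le_of_recip (p q : Polynomial ℂ) (n m : ℕ) (hmn : m ≤ n)
    (hq : Polynomial.X ^ m ∣ q)
    (h : ∀ x : ℂ, x ≠ 0 → p.eval x = x ^ n * q.eval x⁻¹) : p.natDegree ≤ n - m := by
  obtain ⟨q, rfl⟩ := hq
  have key : Polynomial.X ^ q.natDegree * p = Polynomial.X ^ (n - m) * q.reverse := by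
    refine Polynomial.eq_of_infinite_eval_eq _ _ (Set.Infinite.mono (s := {0}ᶜ) ?_ (Set.finite_singleton (0:ℂ)).infinite_compl)
    intro x hx
    have hx : x ≠ 0 := by simpa using hx
    have hr : q.reverse.eval x = x ^ q.natDegree * q.eval x⁻¹ := by
      letI := invertibleOfNonzero (inv_ne_zero hx)
      have := Polynomial.eval₂_reverse_mul_pow (RingHom.id ℂ) x⁻¹ q
      simp only [invOf_eq_inv, inv_inv, ← Polynomial.eval₂_id] at this ⊢
      simp only [Polynomial.eval₂_id] at this ⊢
      rw [← this]
      have hm : x ^ q.natDegree * x⁻¹ ^ q.natDegree = 1 := by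
        rw [← mul_pow, mul_inv_cancel₀ hx, one_pow]
      linear_combination (-Polynomial.eval x q.reverse) * hm
    obtain ⟨k, rfl⟩ := Nat.exists_eq_add_of_le hmn
    simp only [Set.mem_ofPred_eq, Polynomial.eval_mul, Polynomial.eval_pow, Polynomial.eval_X, hr, h x hx, Nat.add_sub_cancel_left]
    have hm : x ^ m * x⁻¹ ^ m = 1 := by rw [← mul_pow, mul_inv_cancel₀ hx, one_pow]
    rw [pow_add]
    linear_combination (x ^ q.natDegree * x ^ k * Polynomial.eval x⁻¹ q) * hm
  by_cases hp : p = 0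
  · simp [hp]
  have hq0 : q.reverse ≠ 0 := by
    intro h0; rw [h0, mul_zero] at key
    simp [hp] at key
  have := congrArg Polynomial.natDegree key
  rw [Polynomial.natDegree_mul (by simp) hp, Polynomial.natDegree_mul (by simp) hq0] at this
  simp only [Polynomial.natDegree_X_pow] at this
  have := Polynomial.reverse_natDegree_le q
  omega

theorem poly_zero_of_many (p : Polynomial ℂ) (n : ℕ) (hp : p.natDegree < n)
    (S : Set P2) (hS : S.ncard = n) (x : P2 → ℂ) (hx : Set.InjOn x S)
    (h : ∀ z ∈ S, p.eval (x z) = 0) : p = 0 := by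
  have hfin : S.Finite := Set.finite_of_ncard_ne_zero (by omega)
  refine Polynomial.eq_zero_of_natDegree_lt_card_of_eval_eq_zero' p (hfin.image x).toFinset ?_ ?_
  · intro y hy
    simp only [Set.Finite.mem_toFinset, Set.mem_image] at hy
    obtain ⟨z, hz, rfl⟩ := hy
    exact h z hz
  · rw [← Set.ncard_eq_toFinset_card _ (hfin.image x), hx.ncard_image, hS]; exact hp

theorem eval_smul_hom {F : MvPolynomial (Fin 3) ℂ} {d : ℕ} (hF : F.IsHomogeneous d)
    (c : ℂ) (v : Fin 3 → ℂ) : eval (c • v) F = c ^ d * eval v F := by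
  rw [MvPolynomial.eval_eq', MvPolynomial.eval_eq', Finset.mul_sum]
  refine Finset.sum_congr rfl fun m hm => ?_
  have h1 : ∑ i, m i = d := by
    have := hF (mem_support_iff.mp hm)
    rw [← this, Finsupp.weight_apply, Finsupp.sum_fintype _ _ (by simp)]
    simp
  simp only [Pi.smul_apply, smul_eq_mul, mul_pow, Finset.prod_mul_distrib, Finset.prod_pow_eq_pow_sum, h1]
  ring

theorem rep_ne_smul {p q : P2} (h : p ≠ q) (c : ℂ) : p.rep ≠ c • q.rep := by
  intro hc
  have hc0 : c ≠ 0 := by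
    rintro rfl; exact p.rep_nonzero (by simpa using hc)
  apply h
  rw [← p.mk_rep, ← q.mk_rep, Projectivization.mk_eq_mk_iff']
  exact ⟨c, hc.symm⟩

/-- Specialized-point version of Proposition 2.2: if `Z` consists of `2d+1` points
with a `d`-rich line `L_Q` and a simple line `L_R` meeting outside `Z`, then any
degree-`d` form through `Z` with a point of multiplicity at least `d-1` at a generic
point `P` of `L_R` vanishes identically. -/
theorem stmt14 (d : ℕ) (hd : 2 ≤ d) (Z : Set P2) (hcard : Z.ncard = 2 * d + 1)
    (LQ LR : Set P2) (hLQ : IsLine LQ) (hLR : IsLine LR)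
    (hQcard : (Z ∩ LQ).ncard = d) (hRcard : (Z ∩ LR).ncard = 2)
    (hmeet : ∀ p : P2, p ∈ LQ → p ∈ LR → p ∉ Z)
    (P : P2) (hPR : P ∈ LR) (hPZ : P ∉ Z) (hPQ : P ∉ LQ)
    (hPgen : ∀ p ∈ Z, ∀ q ∈ Z, p ∉ LR → q ∉ LR → p ≠ q →
      ∀ S : Set P2, IsLine S → p ∈ S → q ∈ S → P ∉ S)
    (F : MvPolynomial (Fin 3) ℂ) (hF : F.IsHomogeneous d)
    (hvan : ∀ p ∈ Z, eval p.rep F = 0)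
    (hmult : ∀ l : List (Fin 3), l.length < d - 1 →
      eval P.rep (l.foldr (fun i G => pderiv i G) F) = 0) :
    F = 0 := by
  classical
  obtain ⟨fQ, hfQ, rfl⟩ := hLQ
  obtain ⟨fR, hfR, rfl⟩ := hLR
  simp only [Set.mem_ofPred_eq] at hmeet hPR hPQ hPgen
  set p := P.rep with hp
  -- affine in the direction of `p`
  have haff : ∀ (v : Fin 3 → ℂ) (t : ℂ),
      eval (v + t • p) F = eval v F + t * (eval (v + p) F - eval v F) := by
    intro v t
    have hdeg : (lineP F v p).natDegree ≤ d - (d - 1) := by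
      refine natDegree_le_of_recip _ (lineP F p v) d (d - 1) (by omega)
        (mult_lineP p v (d - 1) F hmult) ?_
      intro x hx
      rw [eval_lineP, eval_lineP, ← eval_smul_hom hF]
      congr 2
      rw [smul_add, smul_smul, mul_inv_cancel₀ hx, one_smul, add_comm]
    have h1 : (lineP F v p).natDegree ≤ 1 := by omega
    obtain ⟨a, b, hab⟩ := Polynomial.exists_eq_X_add_C_of_natDegree_le_one h1
    have e : ∀ t : ℂ, eval (v + t • p) F = a * t + b := by
      intro t; rw [← eval_lineP, hab]; simp
    have e0 := e 0
    have e1 := e 1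
    simp only [zero_smul, add_zero, one_smul] at e0 e1
    rw [e, e0, e1]; ring
  -- the two points on the line
  obtain ⟨R1, R2, hR12, hRset⟩ := Set.ncard_eq_two.mp hRcard
  have hR1 : R1 ∈ Z ∩ {p : P2 | fR p.rep = 0} := by rw [hRset]; simp
  have hR2 : R2 ∈ Z ∩ {p : P2 | fR p.rep = 0} := by rw [hRset]; simp
  have hR1P : R1 ≠ P := fun h => hPZ (h ▸ hR1.1)
  have hR2P : R2 ≠ P := fun h => hPZ (h ▸ hR2.1)
  have hR1R : fR R1.rep = 0 := hR1.2
  have hR2R : fR R2.rep = 0 := hR2.2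
  set t1 : ℂ := fQ R1.rep / fQ p with ht1
  obtain ⟨r, hr⟩ : ∃ r, r = R1.rep - t1 • p := ⟨_, rfl⟩
  have hrQ : fQ r = 0 := by
    rw [hr]; simp [ht1, hPQ]
  have hrR : fR r = 0 := by rw [hr]; simp [hR1R, hPR]
  have hr0 : r ≠ 0 := by
    intro h; rw [h] at hr
    exact rep_ne_smul hR1P t1 (sub_eq_zero.mp hr.symm)
  obtain ⟨e, he⟩ : ∃ e, fR e ≠ 0 := by
    by_contra! h; exact hfR (LinearMap.ext h)
  obtain ⟨w, hw⟩ : ∃ w, w = e - (fQ e / fQ p) • p := ⟨_, rfl⟩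
  have hwQ : fQ w = 0 := by rw [hw]; simp [hPQ]
  have hwR : fR w ≠ 0 := by rw [hw]; simpa [hPR] using he
  have hli : LinearIndependent ℂ ![p, r, w] := by
    rw [Fintype.linearIndependent_iff]
    intro g hg
    simp only [Fin.sum_univ_three, Matrix.cons_val_zero, Matrix.cons_val_one,
      Matrix.cons_val] at hg
    have h2 : g 2 = 0 := by
      have := congrArg fR hg
      simpa [hPR, hrR, hwR] using this
    have h0 : g 0 = 0 := by
      have := congrArg fQ hg
      simpa [hPQ, hrQ, hwQ] using this
    have h1 : g 1 = 0 := by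
      simpa [h0, h2, hr0] using hg
    intro i; fin_cases i <;> assumption
  let b := basisOfLinearIndependentOfCardEqFinrank hli (by simp)
  have hb0 : b 0 = p := by simp [b]
  have hb1 : b 1 = r := by simp [b]
  have hb2 : b 2 = w := by simp [b]
  have hdec : ∀ v, v = b.coord 0 v • p + b.coord 1 v • r + b.coord 2 v • w := by
    intro v
    have := b.sum_repr v
    rw [Fin.sum_univ_three, hb0, hb1, hb2] at this
    exact this.symm
  have hcR : ∀ v, fR v = b.coord 2 v * fR w := by
    intro v; conv_lhs => rw [hdec v]
    simp [hPR, hrR]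
  have hcQ : ∀ v, fQ v = b.coord 0 v * fQ p := by
    intro v; conv_lhs => rw [hdec v]
    simp [hrQ, hwQ]
  -- values at r
  have hF1 : eval (r + t1 • p) F = 0 := by
    rw [hr, sub_add_cancel]; exact hvan _ hR1.1
  have hdecR2 := hdec R2.rep
  have hz2 : b.coord 2 R2.rep = 0 := by
    have := hcR R2.rep
    rw [hR2R] at this
    exact (mul_eq_zero.mp this.symm).resolve_right hwR
  set c := b.coord 1 R2.rep with hc
  set s := b.coord 0 R2.rep with hs
  rw [hz2, zero_smul, add_zero] at hdecR2
  have hc0 : c ≠ 0 := by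
    intro h0
    rw [h0, zero_smul, add_zero] at hdecR2
    exact rep_ne_smul hR2P _ hdecR2
  have hR2' : R2.rep = c • (r + (s / c) • p) := by
    rw [hdecR2, smul_add, smul_smul, mul_div_cancel₀ _ hc0, add_comm]
  have hF2 : eval (r + (s / c) • p) F = 0 := by
    have := hvan _ hR2.1
    rw [hR2', eval_smul_hom hF] at this
    exact (mul_eq_zero.mp this).resolve_left (pow_ne_zero _ hc0)
  have hts : t1 - s / c ≠ 0 := by
    intro h
    rw [← sub_eq_zero.mp h, hr, sub_add_cancel] at hR2'
    exact rep_ne_smul hR12.symm c hR2'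
  rw [haff] at hF1 hF2
  have hBr : eval (r + p) F - eval r F = 0 := by
    have : (t1 - s / c) * (eval (r + p) F - eval r F) = 0 := by
      linear_combination hF1 - hF2
    exact (mul_eq_zero.mp this).resolve_left hts
  have hAr : eval r F = 0 := by
    rw [hBr, mul_zero, add_zero] at hF1; exact hF1
  -- the coordinate x
  let x : P2 → ℂ := fun z => b.coord 1 z.rep / b.coord 2 z.rep
  have hne : ∀ z : P2, fR z.rep ≠ 0 → b.coord 2 z.rep ≠ 0 := by
    intro z hz h; rw [hcR, h, zero_mul] at hz; exact hz rfl
  have hzval : ∀ z ∈ Z, fR z.rep ≠ 0 →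
      eval ((w + x z • r) + (b.coord 0 z.rep / b.coord 2 z.rep) • p) F = 0 := by
    intro z hz hzR
    have h2 := hne z hzR
    have e : z.rep = b.coord 2 z.rep •
        ((w + x z • r) + (b.coord 0 z.rep / b.coord 2 z.rep) • p) := by
      conv_lhs => rw [hdec z.rep]
      simp only [x, smul_add, smul_smul, mul_div_cancel₀ _ h2]
      abel
    have := hvan z hz
    rw [e, eval_smul_hom hF] at this
    exact (mul_eq_zero.mp this).resolve_left (pow_ne_zero _ h2)
  have hinj : Set.InjOn x {z | z ∈ Z ∧ fR z.rep ≠ 0} := by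
    rintro z ⟨hz, hzR⟩ z' ⟨hz', hzR'⟩ hxx
    by_contra hzz
    have h2 := hne z hzR
    have h2' := hne z' hzR'
    refine hPgen z hz z' hz' hzR hzR' hzz
      {q : P2 | (b.coord 1 - x z • b.coord 2) q.rep = 0} ⟨_, ?_, rfl⟩ ?_ ?_ ?_
    · intro h
      have := congrArg (fun f => f (b 1)) h
      simp at this
    · simp only [Set.mem_ofPred_eq, LinearMap.sub_apply, LinearMap.smul_apply, smul_eq_mul, x]
      rw [div_mul_cancel₀ _ h2, sub_self]
    · rw [hxx]
      simp only [Set.mem_ofPred_eq, LinearMap.sub_apply, LinearMap.smul_apply, smul_eq_mul, x]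
      rw [div_mul_cancel₀ _ h2', sub_self]
    · simp only [Set.mem_ofPred_eq]
      rw [← hp, ← hb0]; simp
  -- A vanishes
  have hX : ∀ q : Polynomial ℂ, q.eval 0 = 0 → Polynomial.X ^ 1 ∣ q := by
    intro q hq
    rw [pow_one, Polynomial.X_dvd_iff, Polynomial.coeff_zero_eq_eval_zero, hq]
  have hflip : ∀ y : ℂ, y ≠ 0 → w + y • r = y • (r + y⁻¹ • w) := by
    intro y hy
    rw [smul_add, smul_smul, mul_inv_cancel₀ hy, one_smul, add_comm]
  have hA : lineP F w r = 0 := by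
    refine poly_zero_of_many _ d ?_ _ hQcard x (hinj.mono ?_) ?_
    · have : (lineP F w r).natDegree ≤ d - 1 := by
        refine natDegree_le_of_recip _ (lineP F r w) d 1 (by omega) (hX _ ?_) ?_
        · rw [eval_lineP]; simpa using hAr
        · intro y hy
          rw [eval_lineP, eval_lineP, hflip y hy, eval_smul_hom hF]
      omega
    · rintro z ⟨hz, hzQ⟩
      exact ⟨hz, fun h => hmeet z hzQ h hz⟩
    · rintro z ⟨hz, hzQ⟩
      have := hzval z hz (fun h => hmeet z hzQ h hz)
      have h0 : b.coord 0 z.rep = 0 := by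
        have h := hcQ z.rep
        rw [show fQ z.rep = 0 from hzQ] at h
        exact (mul_eq_zero.mp h.symm).resolve_right hPQ
      rw [h0, zero_div, zero_smul, add_zero] at this
      rw [eval_lineP, this]
  have hA' : ∀ y : ℂ, eval (w + y • r) F = 0 := by
    intro y; rw [← eval_lineP, hA]; simp
  have hZfin : Z.Finite := Set.finite_of_ncard_ne_zero (by omega)
  have hScard : ((Z \ (Z ∩ {p : P2 | fQ p.rep = 0})) \ (Z ∩ {p : P2 | fR p.rep = 0})).ncard
      = d - 1 := by
    have f1 : (Z ∩ {p : P2 | fQ p.rep = 0}).Finite := hZfin.subset Set.inter_subset_left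
    have f2 : (Z ∩ {p : P2 | fR p.rep = 0}).Finite := hZfin.subset Set.inter_subset_left
    rw [Set.ncard_sdiff ?_ f2, Set.ncard_sdiff Set.inter_subset_left f1, hcard, hQcard, hRcard]
    · omega
    · rintro z ⟨hz, hzR⟩
      exact ⟨hz, fun h => hmeet z h.2 hzR hz⟩
  have hBhom : ∀ (y : ℂ) (v : Fin 3 → ℂ), y ≠ 0 → eval (y • v + p) F - eval (y • v) F =
      y ^ (d - 1) * (eval (v + p) F - eval v F) := by
    intro y v hy
    have h1 : y • v + p = y • (v + y⁻¹ • p) := by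
      rw [smul_add, smul_smul, mul_inv_cancel₀ hy, one_smul]
    rw [h1, eval_smul_hom hF, eval_smul_hom hF, haff]
    obtain ⟨k, rfl⟩ : ∃ k, d = k + 1 := ⟨d - 1, by omega⟩
    rw [Nat.add_sub_cancel, pow_succ]
    field_simp
    ring
  have hB : lineP F (w + p) r - lineP F w r = 0 := by
    refine poly_zero_of_many _ (d - 1) ?_ _ hScard x (hinj.mono ?_) ?_
    · have : (lineP F (w + p) r - lineP F w r).natDegree ≤ d - 1 - 1 := by
        refine natDegree_le_of_recip _ (lineP F (r + p) w - lineP F r w) (d - 1) 1 (by omega)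
          (hX _ ?_) ?_
        · rw [Polynomial.eval_sub, eval_lineP, eval_lineP]; simpa using hBr
        · intro y hy
          rw [Polynomial.eval_sub, Polynomial.eval_sub]
          simp only [eval_lineP]
          rw [add_right_comm w, add_right_comm r, hflip y hy, hBhom y _ hy]
      omega
    · rintro z ⟨⟨hz, hzQ⟩, hzR⟩
      exact ⟨hz, fun h => hzR ⟨hz, h⟩⟩
    · rintro z ⟨⟨hz, hzQ⟩, hzR⟩
      have hzR' : fR z.rep ≠ 0 := fun h => hzR ⟨hz, h⟩
      have := hzval z hz hzR'
      rw [haff, hA', zero_add] at this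
      have h0 : b.coord 0 z.rep ≠ 0 := by
        intro h; apply hzQ; refine ⟨hz, ?_⟩
        show fQ z.rep = 0
        rw [hcQ, h, zero_mul]
      have := (mul_eq_zero.mp this).resolve_left (div_ne_zero h0 (hne z hzR'))
      rw [Polynomial.eval_sub, eval_lineP, eval_lineP, add_right_comm w, hA']
      exact this
  have hB' : ∀ y : ℂ, eval ((w + y • r) + p) F - eval (w + y • r) F = 0 := by
    intro y
    have := congrArg (Polynomial.eval y) hB
    rw [Polynomial.eval_sub, eval_lineP, eval_lineP, add_right_comm w] at this
    simpa using this
  have hgen : ∀ v, b.coord 2 v ≠ 0 → eval v F = 0 := by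
    intro v h2
    have e : v = b.coord 2 v • ((w + (b.coord 1 v / b.coord 2 v) • r)
        + (b.coord 0 v / b.coord 2 v) • p) := by
      conv_lhs => rw [hdec v]
      simp only [smul_add, smul_smul, mul_div_cancel₀ _ h2]
      abel
    rw [e, eval_smul_hom hF, haff, hB', hA']; simp
  apply MvPolynomial.funext
  intro v
  have hl : lineP F v w = 0 := by
    refine Polynomial.eq_zero_of_infinite_isRoot _ (Set.Infinite.mono (s := {-b.coord 2 v}ᶜ) ?_
      (Set.finite_singleton (-b.coord 2 v)).infinite_compl)
    intro y hy
    show Polynomial.eval y _ = 0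
    rw [eval_lineP]
    apply hgen
    rw [map_add, map_smul, ← hb2]
    intro h
    apply hy
    simp at h ⊢
    linear_combination h
  have := eval_lineP F v w 0
  rw [hl] at this
  simpa using this.symm
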